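/- arXiv:1310.4095 — 2 statements merged into one kernel-verified Lean document; each statement's English description precedes it below -/
import Mathlib

section
/- (Proposition 2, components of the non-abelian adiabatic curvature.) Let I ⊆ B and fix x₀ ∈ U; assume λ_a(x₀) ≠ λ_d(x₀) whenever a ∈ I and d ∉ I. Define A_{ab}(u)(x) = ⟪φ_a(x), (D_u φ_b)(x)⟫. Then for all a, b ∈ I and all directions u, v ∈ E, the curvature component F_{I,ab}(u,v) := D_u(A_{ab}(v))(x₀) − D_v(A_{ab}(u))(x₀) + ∑_{c∈I} ( A_{ac}(u)A_{cb}(v) − A_{ac}(v)A_{cb}(u) )(x₀) satisfies F_{I,ab}(u,v) = ∑_{d∉I} [ ⟪φ_a, (D_u H)(φ_d)⟫·⟪φ_d, (D_v H)(φ_b)⟫ − ⟪φ_a, (D_v H)(φ_d)⟫·⟪φ_d, (D_u H)(φ_b)⟫ ] / ( (λ_a(x₀) − λ_d(x₀)) · (λ_b(x₀) − λ_d(x₀)) ), where all quantities are evaluated at x₀. -/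
open scoped ComplexInnerProductSpace

/-- The directional derivative of the pointwise action of a real-differentiable family of
complex-linear operators on a real-differentiable family of vectors. -/
theorem fderiv_complexCLM_apply
    {E : Type*} [NormedAddCommGroup E] [NormedSpace ℝ E]
    {F : Type*} [NormedAddCommGroup F] [NormedSpace ℂ F]
    {G : Type*} [NormedAddCommGroup G] [NormedSpace ℂ G]
    {T : E → F →L[ℂ] G} {f : E → F} {x : E}
    (hT : DifferentiableAt ℝ T x) (hf : DifferentiableAt ℝ f x) (u : E) :
    fderiv ℝ (fun y => T y (f y)) x u = fderiv ℝ T x u (f x) + T x (fderiv ℝ f x u) := by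
  have hR := (ContinuousLinearMap.restrictScalarsL ℂ F G ℝ ℝ).hasFDerivAt.comp x hT.hasFDerivAt
  have h : HasFDerivAt (fun y => T y (f y)) _ x := hR.clm_apply hf.hasFDerivAt
  rw [h.fderiv]
  simp [add_comm]

/-- If `⟪f, g⟫` is locally constant, a derivative can be moved across it with a change of sign. -/
theorem inner_fderiv_eq_neg_of_eventually_const
    {E : Type*} [NormedAddCommGroup E] [NormedSpace ℝ E]
    {H : Type*} [NormedAddCommGroup H] [InnerProductSpace ℂ H]
    {f g : E → H} {x : E} {k : ℂ}
    (hf : DifferentiableAt ℝ f x) (hg : DifferentiableAt ℝ g x)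
    (hc : ∀ᶠ y in nhds x, ⟪f y, g y⟫ = k) (u : E) :
    ⟪fderiv ℝ f x u, g x⟫ = -⟪f x, fderiv ℝ g x u⟫ := by
  have h := fderiv_inner_apply ℂ hf hg u
  have hk : (fun y => ⟪f y, g y⟫) =ᶠ[nhds x] fun _ => k := hc
  rw [hk.fderiv_eq] at h
  simp only [fderiv_fun_const, Pi.zero_apply, zero_apply] at h
  linear_combination -h

/-- Antisymmetrizing the derivative of `⟪f, D g⟫` in the two directions leaves first derivatives only. -/
theorem fderiv_inner_fderiv_sub_swap
    {E : Type*} [NormedAddCommGroup E] [NormedSpace ℝ E]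
    {H : Type*} [NormedAddCommGroup H] [InnerProductSpace ℂ H]
    {f g : E → H} {x : E}
    (hf : DifferentiableAt ℝ f x) (hg : ContDiffAt ℝ 2 g x) (u v : E) :
    fderiv ℝ (fun y => ⟪f y, fderiv ℝ g y v⟫) x u - fderiv ℝ (fun y => ⟪f y, fderiv ℝ g y u⟫) x v
      = ⟪fderiv ℝ f x u, fderiv ℝ g x v⟫ - ⟪fderiv ℝ f x v, fderiv ℝ g x u⟫ := by
  have hd : DifferentiableAt ℝ (fderiv ℝ g) x :=
    (hg.fderiv_right (m := 1) (by norm_num)).differentiableAt (by norm_num)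
  have hsymm : fderiv ℝ (fderiv ℝ g) x u v = fderiv ℝ (fderiv ℝ g) x v u :=
    (hg.isSymmSndFDerivAt (by simp)).eq u v
  have key : ∀ w z : E, fderiv ℝ (fun y => ⟪f y, fderiv ℝ g y w⟫) x z
      = ⟪f x, fderiv ℝ (fderiv ℝ g) x z w⟫ + ⟪fderiv ℝ f x z, fderiv ℝ g x w⟫ := by
    intro w z
    rw [fderiv_inner_apply ℂ hf (hd.clm_apply (differentiableAt_const w)),
      fderiv_clm_apply hd (differentiableAt_const w)]
    simp
  rw [key, key, hsymm]
  ring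

/-- Off-diagonal Hellmann–Feynman formula for a family of symmetric operators. -/
theorem inner_fderiv_apply_eigenvector
    {E : Type*} [NormedAddCommGroup E] [NormedSpace ℝ E]
    {H : Type*} [NormedAddCommGroup H] [InnerProductSpace ℂ H]
    {T : E → H →L[ℂ] H} {f : E → H} {μ : E → ℝ} {x : E} {w : H} {ν : ℝ}
    (hT : DifferentiableAt ℝ T x) (hf : DifferentiableAt ℝ f x) (hμ : DifferentiableAt ℝ μ x)
    (hsymm : ∀ z t : H, ⟪T x z, t⟫ = ⟪z, T x t⟫)
    (heig : ∀ᶠ y in nhds x, T y (f y) = (μ y : ℂ) • f y)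
    (hw : T x w = (ν : ℂ) • w) (horth : ⟪w, f x⟫ = 0) (u : E) :
    ⟪w, fderiv ℝ T x u (f x)⟫ = ((μ x - ν : ℝ) : ℂ) * ⟪w, fderiv ℝ f x u⟫ := by
  have heig_smul : (fun y => T y (f y)) =ᶠ[nhds x] fun y => μ y • f y := by
    filter_upwards [heig] with y hy
    rw [hy, Complex.coe_smul]
  have h : fderiv ℝ T x u (f x) + T x (fderiv ℝ f x u)
      = μ x • fderiv ℝ f x u + fderiv ℝ μ x u • f x := by
    rw [← fderiv_complexCLM_apply hT hf, heig_smul.fderiv_eq, fderiv_fun_smul hμ hf]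
    simp
  have hinner := congrArg (fun z => ⟪w, z⟫) h
  simp only [← Complex.coe_smul, inner_add_right, inner_smul_right, horth, ← hsymm, hw,
    inner_smul_left, Complex.conj_ofReal] at hinner
  push_cast
  linear_combination hinner

/-- Proposition 2: components of the non-abelian adiabatic curvature
`F_{I,ab}(u,v)` equal the sum over `d ∉ I` of
`(⟪φ_a, (D_u H) φ_d⟫⟪φ_d, (D_v H) φ_b⟫ − (u ↔ v)) / ((λ_a − λ_d)(λ_b − λ_d))`. -/
theorem stmt_5
    {E : Type*} [NormedAddCommGroup E] [NormedSpace ℝ E]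
    {H : Type*} [NormedAddCommGroup H] [InnerProductSpace ℂ H] [FiniteDimensional ℂ H]
    {B : Type*} [Fintype B] [DecidableEq B]
    (U : Set E) (hU : IsOpen U) (x₀ : E) (hx₀ : x₀ ∈ U)
    (Hop : E → (H →L[ℂ] H)) (φ : B → E → H) (lam : B → E → ℝ)
    (hsa : ∀ x ∈ U, ∀ v w : H, ⟪Hop x v, w⟫ = ⟪v, Hop x w⟫)
    (heig : ∀ b, ∀ x ∈ U, Hop x (φ b x) = (lam b x : ℂ) • φ b x)
    (hON : ∀ x ∈ U, Orthonormal ℂ (fun b => φ b x))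
    (hspan : ∀ x ∈ U, Submodule.span ℂ (Set.range fun b => φ b x) = ⊤)
    (hH : DifferentiableAt ℝ Hop x₀)
    (hreg : ∀ b, ContDiffOn ℝ 2 (φ b) U)
    (hlam : ∀ b, DifferentiableAt ℝ (lam b) x₀)
    (I : Finset B)
    (hgap : ∀ a ∈ I, ∀ d ∉ I, lam a x₀ ≠ lam d x₀)
    (A : B → B → E → E → ℂ)
    (hA : ∀ a b u x, A a b u x = ⟪φ a x, fderiv ℝ (φ b) x u⟫)
    (a b : B) (ha : a ∈ I) (hb : b ∈ I) (u v : E) :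
    fderiv ℝ (A a b v) x₀ u - fderiv ℝ (A a b u) x₀ v
        + ∑ c ∈ I, (A a c u x₀ * A c b v x₀ - A a c v x₀ * A c b u x₀)
      = ∑ d ∈ Iᶜ,
          (⟪φ a x₀, (fderiv ℝ Hop x₀ u) (φ d x₀)⟫ * ⟪φ d x₀, (fderiv ℝ Hop x₀ v) (φ b x₀)⟫
            - ⟪φ a x₀, (fderiv ℝ Hop x₀ v) (φ d x₀)⟫ * ⟪φ d x₀, (fderiv ℝ Hop x₀ u) (φ b x₀)⟫)
            / (((lam a x₀ - lam d x₀ : ℝ) : ℂ) * ((lam b x₀ - lam d x₀ : ℝ) : ℂ)) := by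
  have hnhds : U ∈ nhds x₀ := hU.mem_nhds hx₀
  have hC : ∀ c, ContDiffAt ℝ 2 (φ c) x₀ := fun c => (hreg c).contDiffAt hnhds
  have hD : ∀ c, DifferentiableAt ℝ (φ c) x₀ := fun c => (hC c).differentiableAt (by norm_num)
  have hskew : ∀ c d w, ⟪fderiv ℝ (φ c) x₀ w, φ d x₀⟫ = -A c d w x₀ := by
    intro c d w
    rw [hA]
    refine inner_fderiv_eq_neg_of_eventually_const (k := if c = d then 1 else 0) (hD c) (hD d) ?_ w
    filter_upwards [hnhds] with y hy
    exact orthonormal_iff_ite.mp (hON y hy) c d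
  have hHF : ∀ c d w, c ≠ d → ⟪φ c x₀, fderiv ℝ Hop x₀ w (φ d x₀)⟫
      = ((lam d x₀ - lam c x₀ : ℝ) : ℂ) * A c d w x₀ := by
    intro c d w hcd
    rw [hA]
    refine inner_fderiv_apply_eigenvector hH (hD d) (hlam d) (hsa x₀ hx₀) ?_ (heig c x₀ hx₀)
      ((hON x₀ hx₀).2 hcd) w
    filter_upwards [hnhds] with y hy
    exact heig d y hy
  have hfun : ∀ w, A a b w = fun y => ⟪φ a y, fderiv ℝ (φ b) y w⟫ := fun w => funext (hA a b w)
  have hparseval : ∀ w z, ⟪fderiv ℝ (φ a) x₀ w, fderiv ℝ (φ b) x₀ z⟫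
      = -∑ c, A a c w x₀ * A c b z x₀ := by
    intro w z
    rw [← (OrthonormalBasis.mk (hON x₀ hx₀) (hspan x₀ hx₀).ge).sum_inner_mul_inner,
      ← Finset.sum_neg_distrib]
    refine Finset.sum_congr rfl fun c _ => ?_
    rw [OrthonormalBasis.coe_mk, hskew, ← hA, neg_mul]
  rw [hfun, hfun, fderiv_inner_fderiv_sub_swap (hD a) (hC b), hparseval, hparseval,
    ← Finset.sum_add_sum_compl I, ← Finset.sum_add_sum_compl I, Finset.sum_sub_distrib]
  have hterm : ∀ d ∈ Iᶜ,
      (⟪φ a x₀, (fderiv ℝ Hop x₀ u) (φ d x₀)⟫ * ⟪φ d x₀, (fderiv ℝ Hop x₀ v) (φ b x₀)⟫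
        - ⟪φ a x₀, (fderiv ℝ Hop x₀ v) (φ d x₀)⟫ * ⟪φ d x₀, (fderiv ℝ Hop x₀ u) (φ b x₀)⟫)
        / (((lam a x₀ - lam d x₀ : ℝ) : ℂ) * ((lam b x₀ - lam d x₀ : ℝ) : ℂ))
      = A a d v x₀ * A d b u x₀ - A a d u x₀ * A d b v x₀ := by
    intro d hd
    have hdI : d ∉ I := Finset.mem_compl.mp hd
    have had : a ≠ d := ne_of_mem_of_not_mem ha hdI
    have hdb : d ≠ b := (ne_of_mem_of_not_mem hb hdI).symm
    have h₁ : ((lam a x₀ - lam d x₀ : ℝ) : ℂ) ≠ 0 :=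
      Complex.ofReal_ne_zero.mpr (sub_ne_zero.mpr (hgap a ha d hdI))
    have h₂ : ((lam b x₀ - lam d x₀ : ℝ) : ℂ) ≠ 0 :=
      Complex.ofReal_ne_zero.mpr (sub_ne_zero.mpr (hgap b hb d hdI))
    rw [hHF a d u had, hHF a d v had, hHF d b u hdb, hHF d b v hdb,
      div_eq_iff (mul_ne_zero h₁ h₂)]
    push_cast
    ring
  rw [Finset.sum_congr rfl hterm, Finset.sum_sub_distrib]
  ring
end

section
/- (Factorizable eigenstate: the average adiabatic curving equals the adiabatic curvature of the environment.) Let ζ : U → H_S and ξ : U → H_E be twice continuously differentiable with ‖ζ(x)‖ = ‖ξ(x)‖ = 1 for all x ∈ U. For a direction u ∈ E define the operator-valued map 𝒜(u) : U → (H_S →L[ℂ] H_S) by 𝒜(u)(x) = |D_uζ(x)⟩⟨ζ(x)| + ⟪ξ(x), D_uξ(x)⟫·|ζ(x)⟩⟨ζ(x)|, and for directions u, v define the adiabatic curving B(u,v)(x₀) = D_u(𝒜(v))(x₀) − D_v(𝒜(u))(x₀) − ( 𝒜(u)(x₀)∘𝒜(v)(x₀) − 𝒜(v)(x₀)∘𝒜(u)(x₀)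 ). Then for every x₀ ∈ U and all u, v ∈ E: Tr( |ζ(x₀)⟩⟨ζ(x₀)| ∘ B(u,v)(x₀) ) = D_u(x ↦ ⟪ξ(x), D_vξ(x)⟫)(x₀) − D_v(x ↦ ⟪ξ(x), D_uξ(x)⟫)(x₀). -/
open scoped ComplexInnerProductSpace

/-- `|v⟩⟨w|` as an operator: `z ↦ ⟪w, z⟫ • v`. -/
noncomputable def ketbraOp {H : Type*} [NormedAddCommGroup H] [InnerProductSpace ℂ H]
    (v w : H) : H →L[ℂ] H :=
  (innerSL ℂ w).smulRight v

lemma trace_ketbraOp_comp {H : Type*} [NormedAddCommGroup H] [InnerProductSpace ℂ H]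
    [FiniteDimensional ℂ H] (z : H) (T : H →L[ℂ] H) :
    LinearMap.trace ℂ H ((ketbraOp z z ∘L T : H →L[ℂ] H) : H →ₗ[ℂ] H) = ⟪z, T z⟫ := by
  have h : ((ketbraOp z z ∘L T : H →L[ℂ] H) : H →ₗ[ℂ] H)
      = LinearMap.smulRight ((innerSL ℂ z ∘L T : H →L[ℂ] ℂ) : H →ₗ[ℂ] ℂ) z := by
    ext w; simp [ketbraOp]
  rw [h, LinearMap.trace_smulRight]
  simp

lemma isBoundedBilinearMap_ketbraOp {H : Type*} [NormedAddCommGroup H] [InnerProductSpace ℂ H] :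
    IsBoundedBilinearMap ℝ (fun p : H × H => ketbraOp p.1 p.2) where
  add_left v v' w := by ext z; simp [ketbraOp]
  smul_left c v w := by ext z; simp [ketbraOp, smul_comm c]
  add_right v w w' := by ext z; simp [ketbraOp, add_smul]
  smul_right c v w := by
    ext z; simp [ketbraOp, ← Complex.coe_smul, mul_smul]
  bound := ⟨1, one_pos, fun v w => by
    have h : ‖ketbraOp v w‖ = ‖v‖ * ‖w‖ := InnerProductSpace.norm_rankOne (𝕜 := ℂ) v w
    simp [h]⟩

lemma HasFDerivAt.ketbraOp {E H : Type*} [NormedAddCommGroup E] [NormedSpace ℝ E]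
    [NormedAddCommGroup H] [InnerProductSpace ℂ H] {f g : E → H} {f' g' : E →L[ℝ] H} {x : E}
    (hf : HasFDerivAt f f' x) (hg : HasFDerivAt g g' x) :
    HasFDerivAt (fun y => _root_.ketbraOp (f y) (g y))
      ((isBoundedBilinearMap_ketbraOp.deriv (f x, g x)).comp (f'.prod g')) x :=
  HasFDerivAt.comp (g := fun p : H × H => _root_.ketbraOp p.1 p.2) x
    (isBoundedBilinearMap_ketbraOp.hasFDerivAt (f x, g x)) (hf.prodMk hg)

/-- The real part of `⟪f, D_u f⟫` vanishes where `f` is locally normalized. -/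
lemma inner_fderiv_add_inner_fderiv_eq_zero {E H : Type*} [NormedAddCommGroup E] [NormedSpace ℝ E]
    [NormedAddCommGroup H] [InnerProductSpace ℂ H] {f : E → H} {x : E} {U : Set E}
    (hU : U ∈ nhds x) (hf : DifferentiableAt ℝ f x) (hn : ∀ y ∈ U, ‖f y‖ = 1) (u : E) :
    ⟪f x, fderiv ℝ f x u⟫ + ⟪fderiv ℝ f x u, f x⟫ = 0 := by
  have h : (fun y => ⟪f y, f y⟫) =ᶠ[nhds x] fun _ => (1 : ℂ) := by
    filter_upwards [hU] with y hy
    rw [inner_self_eq_norm_sq_to_K, hn y hy]; simp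
  rw [← fderiv_inner_apply ℂ hf hf u, h.fderiv_eq]
  simp

/-- The expectation value at `ζ x` of the derivative of
`|D_vζ⟩⟨ζ| + a |ζ⟩⟨ζ|` for a normalized `ζ`. -/
lemma inner_fderiv_ketbraOp_add {E H : Type*} [NormedAddCommGroup E] [NormedSpace ℝ E]
    [NormedAddCommGroup H] [InnerProductSpace ℂ H] {ζ η : E → H} {a : E → ℂ} {x : E}
    (hζ : DifferentiableAt ℝ ζ x) (hη : DifferentiableAt ℝ η x) (ha : DifferentiableAt ℝ a x)
    (hn : ‖ζ x‖ = 1) (u : E)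
    (h0 : ⟪ζ x, fderiv ℝ ζ x u⟫ + ⟪fderiv ℝ ζ x u, ζ x⟫ = 0) :
    ⟪ζ x, fderiv ℝ (fun y => ketbraOp (η y) (ζ y) + a y • ketbraOp (ζ y) (ζ y)) x u (ζ x)⟫
      = ⟪ζ x, fderiv ℝ η x u⟫ - ⟪ζ x, η x⟫ * ⟪ζ x, fderiv ℝ ζ x u⟫ + fderiv ℝ a x u := by
  have h := (hη.hasFDerivAt.ketbraOp hζ.hasFDerivAt).fun_add
    (ha.hasFDerivAt.fun_smul (hζ.hasFDerivAt.ketbraOp hζ.hasFDerivAt))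
  have h2 := eq_neg_of_add_eq_zero_right h0
  rw [h.fderiv]
  simp [ketbraOp, inner_smul_right, hn, h2]
  ring

/-- factorizable eigenstate: the average adiabatic curving
`Tr(|ζ⟩⟨ζ| ∘ B(u,v))` equals the adiabatic curvature of the environment
`D_u⟪ξ, D_vξ⟫ − D_v⟪ξ, D_uξ⟫`, where
`𝒜(u)(x) = |D_uζ(x)⟩⟨ζ(x)| + ⟪ξ(x), D_uξ(x)⟫·|ζ(x)⟩⟨ζ(x)|` and
`B(u,v) = D_u𝒜(v) − D_v𝒜(u) − (𝒜(u)∘𝒜(v) − 𝒜(v)∘𝒜(u))`. -/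
theorem stmt_10
    {E : Type*} [NormedAddCommGroup E] [NormedSpace ℝ E]
    {HS : Type*} [NormedAddCommGroup HS] [InnerProductSpace ℂ HS] [FiniteDimensional ℂ HS]
    {HE : Type*} [NormedAddCommGroup HE] [InnerProductSpace ℂ HE] [FiniteDimensional ℂ HE]
    (U : Set E) (hU : IsOpen U) (x₀ : E) (hx₀ : x₀ ∈ U)
    (ζ : E → HS) (ξ : E → HE)
    (hζ : ContDiffOn ℝ 2 ζ U) (hξ : ContDiffOn ℝ 2 ξ U)
    (hζn : ∀ x ∈ U, ‖ζ x‖ = 1) (hξn : ∀ x ∈ U, ‖ξ x‖ = 1)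
    (A : E → E → (HS →L[ℂ] HS))
    (hA : ∀ u : E, ∀ x ∈ U,
      A u x = ketbraOp (fderiv ℝ ζ x u) (ζ x)
                + ⟪ξ x, fderiv ℝ ξ x u⟫ • ketbraOp (ζ x) (ζ x))
    (u v : E) :
    LinearMap.trace ℂ HS
        ((ketbraOp (ζ x₀) (ζ x₀) ∘L
          (fderiv ℝ (A v) x₀ u - fderiv ℝ (A u) x₀ v
            - (A u x₀ ∘L A v x₀ - A v x₀ ∘L A u x₀)) : HS →L[ℂ] HS) : HS →ₗ[ℂ] HS)
      = fderiv ℝ (fun x => ⟪ξ x, fderiv ℝ ξ x v⟫) x₀ u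
          - fderiv ℝ (fun x => ⟪ξ x, fderiv ℝ ξ x u⟫) x₀ v := by
  have hU' : U ∈ nhds x₀ := hU.mem_nhds hx₀
  have hζ₂ : ContDiffAt ℝ 2 ζ x₀ := hζ.contDiffAt hU'
  have hξ₂ : ContDiffAt ℝ 2 ξ x₀ := hξ.contDiffAt hU'
  have hζd : DifferentiableAt ℝ ζ x₀ := hζ₂.differentiableAt (by norm_num)
  have hξd : DifferentiableAt ℝ ξ x₀ := hξ₂.differentiableAt (by norm_num)
  have hζ' : DifferentiableAt ℝ (fderiv ℝ ζ) x₀ :=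
    (hζ₂.fderiv_right (m := 1) (by norm_num)).differentiableAt (by norm_num)
  have hξ' : DifferentiableAt ℝ (fderiv ℝ ξ) x₀ :=
    (hξ₂.fderiv_right (m := 1) (by norm_num)).differentiableAt (by norm_num)
  have hζw (w : E) : DifferentiableAt ℝ (fun x => fderiv ℝ ζ x w) x₀ :=
    hζ'.clm_apply (differentiableAt_const w)
  have ha (w : E) : DifferentiableAt ℝ (fun x => ⟪ξ x, fderiv ℝ ξ x w⟫) x₀ :=
    hξd.inner ℂ (hξ'.clm_apply (differentiableAt_const w))
  have hsecond (w t : E) :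
      fderiv ℝ (fun x => fderiv ℝ ζ x w) x₀ t = fderiv ℝ (fderiv ℝ ζ) x₀ t w := by
    rw [fderiv_clm_apply hζ' (differentiableAt_const w)]
    simp
  have hsymm : fderiv ℝ (fderiv ℝ ζ) x₀ u v = fderiv ℝ (fderiv ℝ ζ) x₀ v u :=
    (hζ₂.isSymmSndFDerivAt (by simp)).eq u v
  have hderiv (w t : E) : ⟪ζ x₀, fderiv ℝ (A w) x₀ t (ζ x₀)⟫
      = ⟪ζ x₀, fderiv ℝ (fderiv ℝ ζ) x₀ t w⟫
        - ⟪ζ x₀, fderiv ℝ ζ x₀ w⟫ * ⟪ζ x₀, fderiv ℝ ζ x₀ t⟫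
        + fderiv ℝ (fun x => ⟪ξ x, fderiv ℝ ξ x w⟫) x₀ t := by
    have hAw : A w =ᶠ[nhds x₀] fun x => ketbraOp (fderiv ℝ ζ x w) (ζ x)
        + ⟪ξ x, fderiv ℝ ξ x w⟫ • ketbraOp (ζ x) (ζ x) := by
      filter_upwards [hU'] with x hx using hA w x hx
    rw [hAw.fderiv_eq, inner_fderiv_ketbraOp_add hζd (hζw w) (ha w) (hζn x₀ hx₀) t
      (inner_fderiv_add_inner_fderiv_eq_zero hU' hζd hζn t), hsecond]
  have hcomp (w t : E) : ⟪ζ x₀, A w x₀ (A t x₀ (ζ x₀))⟫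
      = (⟪ζ x₀, fderiv ℝ ζ x₀ w⟫ + ⟪ξ x₀, fderiv ℝ ξ x₀ w⟫)
        * (⟪ζ x₀, fderiv ℝ ζ x₀ t⟫ + ⟪ξ x₀, fderiv ℝ ξ x₀ t⟫) := by
    simp [hA _ x₀ hx₀, ketbraOp, inner_add_right, inner_smul_right, hζn x₀ hx₀]
    ring
  rw [trace_ketbraOp_comp]
  simp only [sub_apply, ContinuousLinearMap.comp_apply, inner_sub_right,
    hderiv, hcomp, hsymm]
  ring
end
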